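/- Let n ≥ 3 and let p ≥ 2 with p > n/2. Let m be the least nonnegative integer with (n/(n−2))^m ≥ p/2, set q = p/(p−1), k = n/((n−2)q), τ₀ = 1/2 − 1/p, and α = (1+2τ₀) / ( 2(1+τ₀) + (k−1)^{−1} ). Then there exists a constant C = C(n,p) > 0 such that for every r > 0 and every smooth function u defined on a neighbourhood of the closed ball of radius r about the origin: sup_{B(0,r/2)} |u| ≤ C · ( ⨍_{B(0,r)} u² dx )^{α/2} · ( ∑_{j=0}^{m+1} binom(m+1, j) · ( ⨍_{B(0,r)} ( r^{2j} Δ^{j} u )² dx )^{1/2} )^{1−α}, where ⨍_{B(0,r)} v dx denotes the average (1/|B(0,r)|) ∫_{B(0,r)} v dx. -/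

import Mathlib

open MeasureTheory Metric Set Filter

/-- The Euclidean Laplacian `Δf = ∑ᵢ ∂²f/∂xᵢ²`. -/
noncomputable def lap {n : ℕ} (f : EuclideanSpace ℝ (Fin n) → ℝ) :
    EuclideanSpace ℝ (Fin n) → ℝ :=
  fun x => ∑ i : Fin n,
    fderiv ℝ (fun y => fderiv ℝ f y (EuclideanSpace.single i 1)) x (EuclideanSpace.single i 1)

/-- The `j`-th iterated Laplacian `Δ^j` (with `Δ⁰u = u`). -/
noncomputable def lapIter {n : ℕ} (m : ℕ) (f : EuclideanSpace ℝ (Fin n) → ℝ) :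
    EuclideanSpace ℝ (Fin n) → ℝ :=
  lap^[m] f

open scoped ContDiff

section Laplacian

variable {n : ℕ} {f g : EuclideanSpace ℝ (Fin n) → ℝ}

theorem contDiff_fderiv_apply (hf : ContDiff ℝ ∞ f) (v : EuclideanSpace ℝ (Fin n)) :
    ContDiff ℝ ∞ fun x => fderiv ℝ f x v :=
  (hf.fderiv_right (m := ∞) (by simp)).clm_apply contDiff_const

theorem contDiff_lap (hf : ContDiff ℝ ∞ f) : ContDiff ℝ ∞ (lap f) :=
  ContDiff.sum fun _ _ => contDiff_fderiv_apply (contDiff_fderiv_apply hf _) _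

theorem lapIter_succ (j : ℕ) : lapIter (j + 1) f = lap (lapIter j f) :=
  Function.iterate_succ_apply' ..

theorem lapIter_succ' (j : ℕ) : lapIter (j + 1) f = lapIter j (lap f) := rfl

theorem contDiff_lapIter (hf : ContDiff ℝ ∞ f) (j : ℕ) : ContDiff ℝ ∞ (lapIter j f) := by
  induction j with
  | zero => exact hf
  | succ j ih => rw [lapIter_succ]; exact contDiff_lap ih

theorem tsupport_lap_subset : tsupport (lap f) ⊆ tsupport f := by
  refine closure_minimal (fun x hx => ?_) (isClosed_tsupport f)
  obtain ⟨i, -, hi⟩ := Finset.exists_ne_zero_of_sum_ne_zero (Function.mem_support.1 hx)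
  have h1 (g : EuclideanSpace ℝ (Fin n) → ℝ) (v : EuclideanSpace ℝ (Fin n)) :
      tsupport (fun y => fderiv ℝ g y v) ⊆ tsupport g := tsupport_fderiv_apply_subset ℝ v
  exact h1 _ _ (h1 _ _ (subset_tsupport _ (Function.mem_support.2 hi)))

theorem tsupport_lapIter_subset (j : ℕ) : tsupport (lapIter j f) ⊆ tsupport f := by
  induction j with
  | zero => exact subset_rfl
  | succ j ih => rw [lapIter_succ]; exact tsupport_lap_subset.trans ih

theorem hasCompactSupport_lapIter (hf : HasCompactSupport f) (j : ℕ) :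
    HasCompactSupport (lapIter j f) :=
  hf.of_isClosed_subset (isClosed_tsupport _) (tsupport_lapIter_subset j)

theorem Filter.EventuallyEq.lap {x : EuclideanSpace ℝ (Fin n)} (h : f =ᶠ[nhds x] g) :
    lap f =ᶠ[nhds x] lap g := by
  have key (i : Fin n) : (fun y => fderiv ℝ f y (EuclideanSpace.single i 1)) =ᶠ[nhds x]
      fun y => fderiv ℝ g y (EuclideanSpace.single i 1) := by
    filter_upwards [h.fderiv (𝕜 := ℝ)] with y hy
    rw [hy]
  filter_upwards [eventually_all.2 fun i => (key i).fderiv (𝕜 := ℝ)] with y hy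
  exact Finset.sum_congr rfl fun i _ => by rw [hy i]

theorem Filter.EventuallyEq.lapIter {x : EuclideanSpace ℝ (Fin n)} (h : f =ᶠ[nhds x] g) (j : ℕ) :
    lapIter j f =ᶠ[nhds x] lapIter j g := by
  induction j with
  | zero => exact h
  | succ j ih => rw [lapIter_succ, lapIter_succ]; exact ih.lap

theorem fderiv_comp_add_smul (hf : Differentiable ℝ f) (x : EuclideanSpace ℝ (Fin n)) (s : ℝ)
    (y v : EuclideanSpace ℝ (Fin n)) :
    fderiv ℝ (fun y => f (x + s • y)) y v = s * fderiv ℝ f (x + s • y) v := by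
  have h1 : HasFDerivAt (fun y : EuclideanSpace ℝ (Fin n) => x + s • y)
      (s • ContinuousLinearMap.id ℝ (EuclideanSpace ℝ (Fin n))) y :=
    ((hasFDerivAt_id y).const_smul s).const_add x
  have h2 := (hf (x + s • y)).hasFDerivAt.comp y h1
  have h3 : fderiv ℝ (fun y => f (x + s • y)) y = _ := h2.fderiv
  rw [h3]
  simp

theorem lap_comp_add_smul (hf : ContDiff ℝ ∞ f) (x : EuclideanSpace ℝ (Fin n)) (s : ℝ) :
    lap (fun y => f (x + s • y)) = fun y => s ^ 2 * lap f (x + s • y) := by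
  ext y
  simp only [lap, Finset.mul_sum]
  refine Finset.sum_congr rfl fun i _ => ?_
  simp only [fderiv_comp_add_smul (hf.differentiable (by simp))]
  have hd := (contDiff_fderiv_apply hf (EuclideanSpace.single i 1)).differentiable (by simp)
  have hd' : Differentiable ℝ fun y => fderiv ℝ f (x + s • y) (EuclideanSpace.single i 1) :=
    hd.comp (by fun_prop : Differentiable ℝ fun y : EuclideanSpace ℝ (Fin n) => x + s • y)
  rw [fderiv_const_mul hd'.differentiableAt]
  have := fderiv_comp_add_smul hd x s y (EuclideanSpace.single i 1)
  simp only [_root_.smul_apply, smul_eq_mul, this]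
  ring

theorem lap_const_mul (hf : ContDiff ℝ ∞ f) (c : ℝ) :
    lap (fun y => c * f y) = fun y => c * lap f y := by
  ext y
  simp only [lap, Finset.mul_sum]
  refine Finset.sum_congr rfl fun i _ => ?_
  simp only [fderiv_const_mul (hf.differentiable (by simp)).differentiableAt,
    _root_.smul_apply, smul_eq_mul]
  rw [fderiv_const_mul
    ((contDiff_fderiv_apply hf _).differentiable (by simp)).differentiableAt]
  simp

theorem lapIter_comp_add_smul (hf : ContDiff ℝ ∞ f) (x : EuclideanSpace ℝ (Fin n)) (s : ℝ)
    (j : ℕ) :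
    lapIter j (fun y => f (x + s • y)) = fun y => s ^ (2 * j) * lapIter j f (x + s • y) := by
  induction j with
  | zero => simp [lapIter]
  | succ j ih =>
    have hj := contDiff_lapIter hf j
    rw [lapIter_succ, ih, lap_const_mul (by fun_prop), lap_comp_add_smul hj, lapIter_succ]
    ext y
    ring

theorem integral_mul_lap (hf : ContDiff ℝ ∞ f) (hfc : HasCompactSupport f)
    (hg : ContDiff ℝ ∞ g) :
    ∫ y, f y * lap g y = ∫ y, lap f y * g y := by
  have hcf : Continuous f := hf.continuous
  have hcg : Continuous g := hg.continuous
  have hf' := contDiff_fderiv_apply hf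
  have hg' := contDiff_fderiv_apply hg
  have hf'' (v) := contDiff_fderiv_apply (hf' v) v
  have hg'' (v) := contDiff_fderiv_apply (hg' v) v
  have hcf' (v) : HasCompactSupport fun x => fderiv ℝ f x v := hfc.fderiv_apply ℝ v
  have hcf'' (v) : HasCompactSupport fun x => fderiv ℝ (fun x => fderiv ℝ f x v) x v :=
    (hcf' v).fderiv_apply ℝ v
  have int1 (v) : Integrable fun y => f y * fderiv ℝ (fun x => fderiv ℝ g x v) y v :=
    (hcf.mul (hg'' v).continuous).integrable_of_hasCompactSupport hfc.mul_right
  have int2 (v) : Integrable fun y => fderiv ℝ f y v * fderiv ℝ g y v :=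
    ((hf' v).continuous.mul (hg' v).continuous).integrable_of_hasCompactSupport (hcf' v).mul_right
  have int3 (v) : Integrable fun y => f y * fderiv ℝ g y v :=
    (hcf.mul (hg' v).continuous).integrable_of_hasCompactSupport hfc.mul_right
  have int4 (v) : Integrable fun y => fderiv ℝ (fun x => fderiv ℝ f x v) y v * g y :=
    ((hf'' v).continuous.mul hcg).integrable_of_hasCompactSupport (hcf'' v).mul_right
  have int5 (v) : Integrable fun y => fderiv ℝ f y v * g y :=
    ((hf' v).continuous.mul hcg).integrable_of_hasCompactSupport (hcf' v).mul_right
  simp only [lap, Finset.mul_sum, Finset.sum_mul]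
  rw [integral_finsetSum _ fun i _ => int1 _, integral_finsetSum _ fun i _ => int4 _]
  refine Finset.sum_congr rfl fun i _ => ?_
  rw [integral_mul_fderiv_eq_neg_fderiv_mul_of_integrable (int2 _) (int1 _) (int3 _)
      (fun x _ => hf.differentiable (by simp) x) (fun x _ => (hg' _).differentiable (by simp) x),
    integral_mul_fderiv_eq_neg_fderiv_mul_of_integrable (int4 _) (int2 _) (int5 _)
      (fun x _ => (hf' _).differentiable (by simp) x) (fun x _ => hg.differentiable (by simp) x),
    neg_neg]

theorem integral_mul_lapIter (hf : ContDiff ℝ ∞ f) (hfc : HasCompactSupport f)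
    (hg : ContDiff ℝ ∞ g) (j : ℕ) :
    ∫ y, f y * lapIter j g y = ∫ y, lapIter j f y * g y := by
  induction j generalizing g with
  | zero => rfl
  | succ j ih =>
    rw [lapIter_succ', ih (contDiff_lap hg), lapIter_succ,
      integral_mul_lap (contDiff_lapIter hf j) (hasCompactSupport_lapIter hfc j) hg]

end Laplacian

section Kernels

/-- Smooth radial profiles supported in `(-∞, 1]`, each of which is `-2` times the derivative of
the next one. -/
noncomputable def radialProfile : ℕ → ℝ → ℝ
  | 0 => fun s => expNegInvGlue (1 - s)
  | j + 1 => fun s => (1 / 2) * ∫ t in s..1, radialProfile j t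

theorem hasDerivAt_radialProfile_of_continuous {j : ℕ} (h : Continuous (radialProfile j)) (s : ℝ) :
    HasDerivAt (radialProfile (j + 1)) (-(radialProfile j s) / 2) s := by
  have := (intervalIntegral.integral_hasDerivAt_left (h.intervalIntegrable s 1)
    h.stronglyMeasurable.stronglyMeasurableAtFilter h.continuousAt).const_mul (1 / 2)
  exact this.congr_deriv (by ring)

theorem contDiff_radialProfile (j : ℕ) : ContDiff ℝ ∞ (radialProfile j) := by
  induction j with
  | zero => exact expNegInvGlue.contDiff.comp (contDiff_const.sub contDiff_id)
  | succ j ih =>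
    have h := hasDerivAt_radialProfile_of_continuous ih.continuous
    refine contDiff_infty_iff_deriv.2 ⟨fun s => (h s).differentiableAt, ?_⟩
    rw [deriv_eq h]
    exact ih.neg.div_const 2

theorem radialProfile_eq_zero (j : ℕ) {s : ℝ} (hs : 1 ≤ s) : radialProfile j s = 0 := by
  induction j generalizing s with
  | zero => exact expNegInvGlue.zero_of_nonpos (by linarith)
  | succ j ih =>
    have : ∫ t in s..1, radialProfile j t = 0 := by
      refine intervalIntegral.integral_zero_ae (ae_of_all _ fun t ht => ih ?_)
      rw [uIoc_of_ge hs] at ht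
      exact ht.1.le
    simp [radialProfile, this]

/-- The radial kernels `y ↦ radialProfile j (‖y‖²)`. -/
noncomputable def radialKernel {n : ℕ} (j : ℕ) (y : EuclideanSpace ℝ (Fin n)) : ℝ :=
  radialProfile j (‖y‖ ^ 2)

variable {n : ℕ}

theorem contDiff_radialKernel (j : ℕ) :
    ContDiff ℝ ∞ (radialKernel j : EuclideanSpace ℝ (Fin n) → ℝ) :=
  (contDiff_radialProfile j).comp (contDiff_norm_sq ℝ)

theorem radialKernel_eq_zero (j : ℕ) {y : EuclideanSpace ℝ (Fin n)} (hy : 1 ≤ ‖y‖) :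
    radialKernel j y = 0 :=
  radialProfile_eq_zero j (one_le_pow₀ hy)

theorem tsupport_radialKernel_subset (j : ℕ) :
    tsupport (radialKernel j : EuclideanSpace ℝ (Fin n) → ℝ) ⊆ closedBall 0 1 := by
  refine closure_minimal (fun y hy => ?_) isClosed_closedBall
  by_contra h
  rw [mem_closedBall_zero_iff, not_le] at h
  exact hy (radialKernel_eq_zero j h.le)

theorem hasCompactSupport_radialKernel (j : ℕ) :
    HasCompactSupport (radialKernel j : EuclideanSpace ℝ (Fin n) → ℝ) :=
  (isCompact_closedBall 0 1).of_isClosed_subset (isClosed_tsupport _)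
    (tsupport_radialKernel_subset j)

theorem fderiv_radialKernel_succ (j : ℕ) (y : EuclideanSpace ℝ (Fin n)) (i : Fin n) :
    fderiv ℝ (radialKernel (j + 1)) y (EuclideanSpace.single i 1) = -(radialKernel j y * y i) := by
  have h := (hasDerivAt_radialProfile_of_continuous (contDiff_radialProfile j).continuous
    (‖y‖ ^ 2)).comp_hasFDerivAt y (hasStrictFDerivAt_norm_sq y).hasFDerivAt
  have h' : fderiv ℝ (radialKernel (j + 1)) y = _ := h.fderiv
  rw [h']
  simp [radialKernel, EuclideanSpace.inner_single_right]
  ring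

theorem integral_radialKernel_zero_pos :
    0 < ∫ y : EuclideanSpace ℝ (Fin n), radialKernel 0 y := by
  refine (contDiff_radialKernel 0).continuous.integral_pos_of_hasCompactSupport_nonneg_nonzero
    (hasCompactSupport_radialKernel 0) (fun y => expNegInvGlue.nonneg _) (x := 0) ?_
  exact (expNegInvGlue.pos_of_pos (by simp)).ne'

theorem hasDerivAt_integral_radialKernel (j : ℕ) {v : EuclideanSpace ℝ (Fin n) → ℝ}
    (hv : ContDiff ℝ ∞ v) (hvc : HasCompactSupport v) (s : ℝ) :
    HasDerivAt (fun s : ℝ => ∫ y, radialKernel j y * v (s • y))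
      (s * ∫ y, radialKernel (j + 1) y * lap v (s • y)) s := by
  have hK := contDiff_radialKernel (n := n) j
  have hKc := hasCompactSupport_radialKernel (n := n) j
  have hK' := contDiff_radialKernel (n := n) (j + 1)
  have hKc' := hasCompactSupport_radialKernel (n := n) (j + 1)
  have hvd : Differentiable ℝ v := hv.differentiable (by simp)
  have hfv : Continuous (fderiv ℝ v) := hv.continuous_fderiv (by simp)
  obtain ⟨C, hC⟩ := (hvc.fderiv ℝ).exists_bound_of_continuous hfv
  have hvi (i : Fin n) := contDiff_fderiv_apply hv (EuclideanSpace.single i 1)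
  have hvi' (i : Fin n) : ContDiff ℝ ∞ fun y => fderiv ℝ v (s • y) (EuclideanSpace.single i 1) :=
    (hvi i).comp (contDiff_const_smul s)
  have hvii (i : Fin n) (y : EuclideanSpace ℝ (Fin n)) :
      fderiv ℝ (fun y => fderiv ℝ v (s • y) (EuclideanSpace.single i 1)) y
        (EuclideanSpace.single i 1) = s * fderiv ℝ (fun y => fderiv ℝ v y
          (EuclideanSpace.single i 1)) (s • y) (EuclideanSpace.single i 1) := by
    simpa using fderiv_comp_add_smul ((hvi i).differentiable (by simp)) 0 s y
      (EuclideanSpace.single i 1)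
  have hmain := (hasDerivAt_integral_of_dominated_loc_of_deriv_le (μ := volume) (x₀ := s)
    (s := univ) (F := fun s y => radialKernel j y * v (s • y))
    (F' := fun s y => radialKernel j y * fderiv ℝ v (s • y) y)
    (bound := fun y => ‖radialKernel j y‖ * C) univ_mem ?_ ?_ ?_ ?_ ?_ ?_).2
  · refine hmain.congr_deriv ?_
    have hsum (y : EuclideanSpace ℝ (Fin n)) : radialKernel j y * fderiv ℝ v (s • y) y =
        ∑ i, -(fderiv ℝ (radialKernel (j + 1)) y (EuclideanSpace.single i 1) *
          fderiv ℝ v (s • y) (EuclideanSpace.single i 1)) := by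
      have hy : y = ∑ i, y i • EuclideanSpace.single i (1 : ℝ) := by
        simpa using ((EuclideanSpace.basisFun (Fin n) ℝ).sum_repr y).symm
      conv_lhs => rw [hy, map_sum, ← hy]
      rw [Finset.mul_sum]
      refine Finset.sum_congr rfl fun i _ => ?_
      rw [fderiv_radialKernel_succ, map_smul, smul_eq_mul]
      ring
    have hKi (i : Fin n) := contDiff_fderiv_apply hK' (EuclideanSpace.single i 1)
    have hKic (i : Fin n) := hKc'.fderiv_apply ℝ (EuclideanSpace.single i (1 : ℝ))
    have hvi'' (i : Fin n) := contDiff_fderiv_apply (hvi' i) (EuclideanSpace.single i 1)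
    have int1 (i : Fin n) : Integrable fun y =>
        fderiv ℝ (radialKernel (j + 1)) y (EuclideanSpace.single i 1) *
          fderiv ℝ v (s • y) (EuclideanSpace.single i 1) :=
      ((hKi i).continuous.mul (hvi' i).continuous).integrable_of_hasCompactSupport
        (hKic i).mul_right
    have int2 (i : Fin n) : Integrable fun y => radialKernel (j + 1) y *
        fderiv ℝ (fun y => fderiv ℝ v (s • y) (EuclideanSpace.single i 1)) y
          (EuclideanSpace.single i 1) :=
      (hK'.continuous.mul (hvi'' i).continuous).integrable_of_hasCompactSupport hKc'.mul_right
    have int3 (i : Fin n) : Integrable fun y => radialKernel (j + 1) y *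
        fderiv ℝ v (s • y) (EuclideanSpace.single i 1) :=
      (hK'.continuous.mul (hvi' i).continuous).integrable_of_hasCompactSupport hKc'.mul_right
    simp_rw [hsum]
    rw [integral_finsetSum _ fun i _ => (int1 i).fun_neg, ← integral_const_mul]
    simp only [lap, Finset.mul_sum]
    rw [integral_finsetSum]
    · refine Finset.sum_congr rfl fun i _ => ?_
      rw [integral_neg, ← integral_mul_fderiv_eq_neg_fderiv_mul_of_integrable (int1 i) (int2 i)
        (int3 i) (fun x _ => hK'.differentiable (by simp) x)
        (fun x _ => (hvi' i).differentiable (by simp) x)]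
      simp_rw [hvii, mul_left_comm]
    · intro i _
      have := int2 i
      simp_rw [hvii] at this
      simpa only [mul_left_comm] using this
  · refine Eventually.of_forall fun s => Continuous.aestronglyMeasurable ?_
    have := hK.continuous
    have := hv.continuous
    fun_prop
  · have := hv.continuous
    exact (hK.continuous.mul (by fun_prop)).integrable_of_hasCompactSupport hKc.mul_right
  · have := hK.continuous
    exact Continuous.aestronglyMeasurable (by fun_prop)
  · refine ae_of_all _ fun y s _ => ?_
    rw [norm_mul]
    rcases le_total 1 ‖y‖ with hy | hy
    · simp [radialKernel_eq_zero j hy]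
    · gcongr
      calc ‖fderiv ℝ v (s • y) y‖ ≤ ‖fderiv ℝ v (s • y)‖ * ‖y‖ :=
            ContinuousLinearMap.le_opNorm _ _
        _ ≤ ‖fderiv ℝ v (s • y)‖ * 1 := by gcongr
        _ ≤ C := by simpa using hC _
  · exact ((hK.continuous.integrable_of_hasCompactSupport hKc).norm).mul_const C
  · refine ae_of_all _ fun y s _ => ?_
    have h1 : HasDerivAt (fun s : ℝ => s • y) y s := by
      simpa using (hasDerivAt_id s).smul_const y
    exact ((hvd (s • y)).hasFDerivAt.comp_hasDerivAt s h1).const_mul _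

end Kernels

section MeanValue

variable {n : ℕ}

theorem setIntegral_ball_comp_add_smul (f : EuclideanSpace ℝ (Fin n) → ℝ)
    (x : EuclideanSpace ℝ (Fin n)) {ρ : ℝ} (hρ : 0 < ρ) :
    ∫ y in ball 0 1, f (x + ρ • y) = (ρ ^ n)⁻¹ * ∫ y in ball x ρ, f y := by
  rw [Measure.setIntegral_comp_smul_of_pos volume (fun z => f (x + z)) _ hρ,
    smul_unitBall_of_pos hρ, finrank_euclideanSpace_fin, smul_eq_mul]
  congr 1
  have h := (measurePreserving_add_left volume x).setIntegral_preimage_emb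
    (measurableEmbedding_addLeft x) f (ball x ρ)
  rwa [preimage_add_ball, sub_self] at h

theorem exists_abs_integral_mul_le {H : EuclideanSpace ℝ (Fin n) → ℝ} (hH : Continuous H)
    (hsupp : tsupport H ⊆ closedBall 0 1) :
    ∃ C : ℝ, 0 ≤ C ∧ ∀ w : EuclideanSpace ℝ (Fin n) → ℝ, Continuous w → HasCompactSupport w →
      |∫ y, H y * w y| ≤ C * √(∫ y in ball 0 1, w y ^ 2) := by
  have hHc : HasCompactSupport H :=
    (isCompact_closedBall 0 1).of_isClosed_subset (isClosed_tsupport _) hsupp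
  refine ⟨√(∫ y in ball 0 1, H y ^ 2), Real.sqrt_nonneg _, fun w hw hwc => ?_⟩
  have hzero : ∀ y ∉ ball (0 : EuclideanSpace ℝ (Fin n)) 1, H y * w y = 0 := by
    intro y hy
    by_contra h
    refine hy ?_
    rw [← interior_closedBall (0 : EuclideanSpace ℝ (Fin n)) one_ne_zero]
    exact interior_maximal ((subset_tsupport H).trans hsupp) hH.isOpen_support
      (left_ne_zero_of_mul h)
  rw [← setIntegral_eq_integral_of_forall_compl_eq_zero hzero]
  have hmem (f : EuclideanSpace ℝ (Fin n) → ℝ) (hf : Continuous f) (hfc : HasCompactSupport f) :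
      MemLp (fun y => |f y|) (ENNReal.ofReal 2) (volume.restrict (ball 0 1)) :=
    ((hf.memLp_of_hasCompactSupport hfc).restrict _).abs
  have h := integral_mul_le_Lp_mul_Lq_of_nonneg Real.HolderConjugate.two_two
    (ae_of_all _ fun y => abs_nonneg (H y)) (ae_of_all _ fun y => abs_nonneg (w y))
    (hmem H hH hHc) (hmem w hw hwc)
  refine (abs_integral_le_integral_abs).trans ?_
  simpa [abs_mul, Real.sqrt_eq_rpow] using h

/-- The alternating sum of the averages of `Δ^j v`, `j ≤ m`, at scale `s` equals `v 0` up to a constant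
at `s = 0`, and its derivative in `s` only involves `Δ^(m+1) v`. -/
theorem hasDerivAt_sum_integral_radialKernel {v : EuclideanSpace ℝ (Fin n) → ℝ}
    (hv : ContDiff ℝ ∞ v) (hvc : HasCompactSupport v) (m : ℕ) (s : ℝ) :
    HasDerivAt (fun s : ℝ => ∑ j ∈ Finset.range (m + 1), (-1) ^ j * ((s ^ 2 / 2) ^ j / j.factorial) *
        ∫ y, radialKernel j y * lapIter j v (s • y))
      ((-1) ^ m * (s * (s ^ 2 / 2) ^ m / m.factorial) *
        ∫ y, radialKernel (m + 1) y * lapIter (m + 1) v (s • y)) s := by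
  have hF (j : ℕ) := hasDerivAt_integral_radialKernel j (contDiff_lapIter hv j)
    (hasCompactSupport_lapIter hvc j) s
  simp only [← lapIter_succ] at hF
  induction m with
  | zero => simpa using hF 0
  | succ m ih =>
    simp_rw [Finset.sum_range_succ _ (m + 1)]
    have h2 : HasDerivAt (fun s : ℝ => s ^ 2 / 2) s s := by
      simpa using ((hasDerivAt_id s).pow 2).div_const 2
    have h3 := (((h2.fun_pow (m + 1)).div_const ((m + 1).factorial : ℝ)).const_mul
      ((-1 : ℝ) ^ (m + 1))).fun_mul (hF (m + 1))
    refine (ih.fun_add h3).congr_deriv ?_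
    have : (m.factorial : ℝ) ≠ 0 := by positivity
    rw [Nat.factorial_succ]
    push_cast
    field_simp
    ring

theorem exists_abs_apply_zero_le (m : ℕ) (hm : n < 4 * (m + 1)) :
    ∃ C : ℝ, 0 < C ∧ ∀ v : EuclideanSpace ℝ (Fin n) → ℝ, ContDiff ℝ ∞ v → HasCompactSupport v →
      |v 0| ≤ C * (√(∫ y in ball 0 1, v y ^ 2) +
        √(∫ y in ball 0 1, lapIter (m + 1) v y ^ 2)) := by
  have hKs (j : ℕ) : ContDiff ℝ ∞ (lapIter j (radialKernel (n := n) j)) :=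
    contDiff_lapIter (contDiff_radialKernel j) j
  choose A hA0 hA using fun j => exists_abs_integral_mul_le (hKs j).continuous
    ((tsupport_lapIter_subset j).trans (tsupport_radialKernel_subset j))
  obtain ⟨B, hB0, hB⟩ := exists_abs_integral_mul_le
    (contDiff_radialKernel (n := n) (m + 1)).continuous (tsupport_radialKernel_subset (m + 1))
  set I := ∫ y : EuclideanSpace ℝ (Fin n), radialKernel 0 y
  have hI : 0 < I := integral_radialKernel_zero_pos
  set γ : ℝ := 2 * (m + 1) - n / 2 with hγ
  have hγ0 : 0 < γ := by
    have : (n : ℝ) < 4 * (m + 1) := by exact_mod_cast hm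
    rw [hγ]; linarith
  refine ⟨I⁻¹ * (∑ j ∈ Finset.range (m + 1), A j + B / γ + 1), ?_, fun v hv hvc => ?_⟩
  · have := Finset.sum_nonneg fun j (_ : j ∈ Finset.range (m + 1)) => hA0 j
    positivity
  set P := √(∫ y in ball 0 1, v y ^ 2)
  set Q := √(∫ y in ball 0 1, lapIter (m + 1) v y ^ 2)
  have hP : 0 ≤ P := Real.sqrt_nonneg _
  have hQ : 0 ≤ Q := Real.sqrt_nonneg _
  set F : ℕ → ℝ → ℝ := fun j s => ∫ y, radialKernel j y * lapIter j v (s • y) with hF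
  set G : ℝ → ℝ := fun s => ∑ j ∈ Finset.range (m + 1),
    (-1) ^ j * ((s ^ 2 / 2) ^ j / j.factorial) * F j s with hG
  have hderiv := hasDerivAt_sum_integral_radialKernel hv hvc m
  have hFcont : Continuous (F (m + 1)) := continuous_iff_continuousAt.2 fun s =>
    (hasDerivAt_integral_radialKernel (m + 1) (contDiff_lapIter hv _)
      (hasCompactSupport_lapIter hvc _) s).continuousAt
  have hG0 : G 0 = I * v 0 := by
    simp only [hG, Finset.sum_range_succ']
    simp [hF, I, lapIter, integral_mul_const]
  have hG1 : |G 1| ≤ (∑ j ∈ Finset.range (m + 1), A j) * P := by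
    rw [Finset.sum_mul]
    refine (Finset.abs_sum_le_sum_abs _ _).trans (Finset.sum_le_sum fun j _ => ?_)
    have h1 : |F j 1| ≤ A j * P := by
      simp only [hF, one_smul]
      rw [integral_mul_lapIter (contDiff_radialKernel j) (hasCompactSupport_radialKernel j) hv]
      exact hA j v hv.continuous hvc
    have h2 : |((1 : ℝ) ^ 2 / 2) ^ j / j.factorial| ≤ 1 := by
      rw [abs_of_nonneg (by positivity)]
      refine div_le_one_of_le₀ ((pow_le_one₀ (by norm_num) (by norm_num)).trans ?_) (by positivity)
      exact_mod_cast Nat.factorial_pos j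
    rw [abs_mul, abs_mul, abs_pow, abs_neg, abs_one, one_pow, one_mul]
    exact (mul_le_of_le_one_left (abs_nonneg _) h2).trans h1
  have hFm (s : ℝ) (hs : s ∈ Ioc (0 : ℝ) 1) : |F (m + 1) s| ≤ B * (s ^ (-(n : ℝ) / 2) * Q) := by
    have hw := contDiff_lapIter hv (m + 1)
    refine (hB (fun y => lapIter (m + 1) v (s • y)) (by have := hw.continuous; fun_prop)
      ((hasCompactSupport_lapIter hvc _).comp_smul hs.1.ne')).trans ?_
    refine mul_le_mul_of_nonneg_left ?_ hB0
    have h1 := setIntegral_ball_comp_add_smul (fun y => lapIter (m + 1) v y ^ 2) 0 hs.1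
    simp only [zero_add] at h1
    rw [h1, Real.sqrt_mul (by have := hs.1; positivity)]
    have h2 : √(s ^ n)⁻¹ = s ^ (-(n : ℝ) / 2) := by
      rw [Real.sqrt_eq_rpow, ← Real.rpow_natCast, ← Real.rpow_neg hs.1.le, ← Real.rpow_mul hs.1.le]
      ring_nf
    rw [h2]
    have := hs.1
    refine mul_le_mul_of_nonneg_left (Real.sqrt_le_sqrt ?_) (by positivity)
    refine setIntegral_mono_set ?_ (ae_of_all _ fun y => sq_nonneg _)
      (ball_subset_ball hs.2).eventuallyLE
    have : Continuous fun y => lapIter (m + 1) v y ^ 2 := hw.continuous.pow 2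
    exact (this.continuousOn.integrableOn_compact (isCompact_closedBall 0 1)).mono_set
      ball_subset_closedBall
  have hdiff : |G 1 - G 0| ≤ B / γ * Q := by
    rw [← intervalIntegral.integral_eq_sub_of_hasDerivAt (fun s _ => hderiv s)
      (Continuous.intervalIntegrable (.mul (by fun_prop) hFcont) 0 1)]
    have h1 : ∫ s in (0 : ℝ)..1, B * Q * s ^ (γ - 1) = B / γ * Q := by
      rw [intervalIntegral.integral_const_mul, integral_rpow (Or.inl (by linarith))]
      simp [hγ0.ne']
      ring
    rw [← h1, ← Real.norm_eq_abs]
    refine intervalIntegral.norm_integral_le_of_norm_le zero_le_one (ae_of_all _ fun s hs => ?_)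
      ((intervalIntegral.intervalIntegrable_rpow' (by linarith)).const_mul _)
    have hs0 : 0 < s := hs.1
    rw [norm_mul, norm_mul, norm_pow, norm_neg, norm_one, one_pow, one_mul]
    have h2 : ‖s * (s ^ 2 / 2) ^ m / m.factorial‖ ≤ s ^ (2 * m + 1) := by
      rw [Real.norm_of_nonneg (by positivity)]
      refine (div_le_self (by positivity) (by exact_mod_cast Nat.factorial_pos m)).trans ?_
      calc s * (s ^ 2 / 2) ^ m ≤ s * (s ^ 2) ^ m := by gcongr; linarith [sq_nonneg s]
        _ = s ^ (2 * m + 1) := by ring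
    have h3 : s ^ (2 * m + 1) * s ^ (-(n : ℝ) / 2) = s ^ (γ - 1) := by
      rw [← Real.rpow_natCast, ← Real.rpow_add hs0, hγ]
      push_cast
      ring_nf
    calc _ ≤ s ^ (2 * m + 1) * (B * (s ^ (-(n : ℝ) / 2) * Q)) := by
          gcongr
          exact hFm s hs
      _ = B * Q * s ^ (γ - 1) := by rw [← h3]; ring
  have hfin : I * |v 0| ≤ (∑ j ∈ Finset.range (m + 1), A j) * P + B / γ * Q := by
    rw [← abs_of_pos hI, ← abs_mul, ← hG0]
    have := abs_sub_abs_le_abs_sub (G 0) (G 1)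
    rw [abs_sub_comm] at this
    linarith
  have hA' := Finset.sum_nonneg fun j (_ : j ∈ Finset.range (m + 1)) => hA0 j
  have hB' : 0 ≤ B / γ := by positivity
  rw [mul_assoc, inv_mul_eq_div, le_div_iff₀' hI]
  nlinarith [mul_nonneg hA' hQ, mul_nonneg hB' hP]

theorem exists_abs_apply_le (m : ℕ) (hm : n < 4 * (m + 1)) :
    ∃ C : ℝ, 0 < C ∧ ∀ v : EuclideanSpace ℝ (Fin n) → ℝ, ContDiff ℝ ∞ v → HasCompactSupport v →
      ∀ (x : EuclideanSpace ℝ (Fin n)) (ρ : ℝ), 0 < ρ →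
      |v x| ≤ C * (√((ρ ^ n)⁻¹ * ∫ y in ball x ρ, v y ^ 2) +
        √((ρ ^ n)⁻¹ * ∫ y in ball x ρ, (ρ ^ (2 * (m + 1)) * lapIter (m + 1) v y) ^ 2)) := by
  obtain ⟨C, hC, h⟩ := exists_abs_apply_zero_le (n := n) m hm
  refine ⟨C, hC, fun v hv hvc x ρ hρ => ?_⟩
  have hemb : Topology.IsClosedEmbedding fun y : EuclideanSpace ℝ (Fin n) => x + ρ • y :=
    (Homeomorph.addLeft x).isClosedEmbedding.comp (Homeomorph.smulOfNeZero ρ hρ.ne').isClosedEmbedding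
  have := h (fun y => v (x + ρ • y)) (by fun_prop) (hvc.comp_isClosedEmbedding hemb)
  rw [lapIter_comp_add_smul hv,
    setIntegral_ball_comp_add_smul (fun y => v y ^ 2) x hρ,
    setIntegral_ball_comp_add_smul (fun y => (ρ ^ (2 * (m + 1)) * lapIter (m + 1) v y) ^ 2) x hρ]
    at this
  simpa using this

end MeanValue

theorem exists_contDiff_hasCompactSupport_eventuallyEq {n : ℕ}
    {u : EuclideanSpace ℝ (Fin n) → ℝ} {U : Set (EuclideanSpace ℝ (Fin n))} {r : ℝ}
    (hr : 0 < r) (hU : IsOpen U) (hrU : closedBall 0 r ⊆ U) (hu : ContDiffOn ℝ ∞ u U) :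
    ∃ v : EuclideanSpace ℝ (Fin n) → ℝ, ContDiff ℝ ∞ v ∧ HasCompactSupport v ∧
      ∀ y ∈ closedBall 0 r, v =ᶠ[nhds y] u := by
  obtain ⟨δ, hδ, hδU⟩ := (isCompact_closedBall 0 r).exists_cthickening_subset_open hU hrU
  rw [cthickening_closedBall hδ.le hr.le] at hδU
  let χ : ContDiffBump (0 : EuclideanSpace ℝ (Fin n)) :=
    ⟨r + δ / 2, r + δ, by linarith, by linarith⟩
  refine ⟨fun y => χ y * u y, ?_, χ.hasCompactSupport.mul_right, fun y hy => ?_⟩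
  · refine contDiff_iff_contDiffAt.2 fun y => ?_
    by_cases hy : y ∈ tsupport fun y => χ y * u y
    swap
    · exact contDiffAt_const.congr_of_eventuallyEq (notMem_tsupport_iff_eventuallyEq.1 hy)
    have hyU : y ∈ U := by
      refine hδU ?_
      have := closure_mono (Function.support_mul_subset_left χ u) hy
      rw [← tsupport, χ.tsupport_eq] at this
      exact closedBall_subset_closedBall (add_comm _ _).le this
    exact χ.contDiff.contDiffAt.mul (hu.contDiffAt (hU.mem_nhds hyU))
  · have h : y ∈ ball (0 : EuclideanSpace ℝ (Fin n)) χ.rIn := by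
      rw [mem_closedBall] at hy
      rw [mem_ball]
      exact hy.trans_lt (by simp only [χ]; linarith)
    filter_upwards [χ.eventuallyEq_one_of_mem_ball h] with z hz
    simp [hz]

theorem le_rpow_mul_rpow_of_forall_le {X K γ α a S : ℝ} {N : ℕ} (hK : 0 ≤ K)
    (hN : 0 < N) (ha : 0 ≤ a) (haS : a ≤ S) (hα : 0 < α) (hαγ : α ≤ 1 - γ / N)
    (h : ∀ t : ℝ, 0 < t → t ≤ 1 / 2 → X ≤ K * (t ^ (-γ) * (a + t ^ N * S))) :
    X ≤ K * 2 ^ (γ + 1) * a ^ α * S ^ (1 - α) := by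
  rcases (ha.trans haS).eq_or_lt with rfl | hS
  · obtain rfl : a = 0 := le_antisymm haS ha
    have := h (1 / 2) (by norm_num) le_rfl
    simpa [Real.zero_rpow hα.ne'] using this
  have key (b : ℝ) (hb : 0 < b) (hab : a ≤ b) (hbS : b ≤ S) :
      X ≤ K * 2 ^ (γ + 1) * b ^ α * S ^ (1 - α) := by
    have hN' : (0 : ℝ) < N := by exact_mod_cast hN
    have ht : 0 < b / S := by positivity
    have ht1 : b / S ≤ 1 := (div_le_one hS).2 hbS
    have hs : 0 < (b / S) ^ (1 / N : ℝ) := by positivity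
    have hs1 : (b / S) ^ (1 / N : ℝ) ≤ 1 := Real.rpow_le_one ht.le ht1 (by positivity)
    refine (h ((b / S) ^ (1 / N : ℝ) / 2) (by positivity) (by linarith)).trans ?_
    have h1 : ((b / S) ^ (1 / N : ℝ) / 2) ^ N * S ≤ b := by
      rw [div_pow, ← Real.rpow_natCast, ← Real.rpow_mul ht.le, one_div_mul_cancel hN'.ne',
        Real.rpow_one]
      calc b / S / 2 ^ N * S = b / 2 ^ N := by field_simp
        _ ≤ b := div_le_self hb.le (one_le_pow₀ one_le_two)
    have h2 : ((b / S) ^ (1 / N : ℝ) / 2) ^ (-γ) = 2 ^ γ * (b / S) ^ (-(γ / N)) := by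
      rw [Real.div_rpow hs.le zero_le_two, ← Real.rpow_mul ht.le, Real.rpow_neg zero_le_two,
        div_inv_eq_mul, mul_comm]
      ring_nf
    have h3 : (b / S) ^ (-(γ / N)) * (b / S) ≤ (b / S) ^ α := by
      rw [← Real.rpow_add_one ht.ne']
      exact Real.rpow_le_rpow_of_exponent_ge ht ht1 (by linarith)
    have h4 : (b / S) ^ α * S = b ^ α * S ^ (1 - α) := by
      rw [Real.div_rpow hb.le hS.le, Real.rpow_sub hS, Real.rpow_one]
      field_simp
    rw [h2]
    calc K * (2 ^ γ * (b / S) ^ (-(γ / N)) * (a + ((b / S) ^ (1 / N : ℝ) / 2) ^ N * S))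
        ≤ K * (2 ^ γ * (b / S) ^ (-(γ / N)) * (b + b)) := by gcongr
      _ = K * 2 ^ (γ + 1) * ((b / S) ^ (-(γ / N)) * (b / S) * S) := by
          rw [Real.rpow_add_one two_ne_zero]
          field_simp
          ring
      _ ≤ K * 2 ^ (γ + 1) * ((b / S) ^ α * S) := by gcongr
      _ = K * 2 ^ (γ + 1) * b ^ α * S ^ (1 - α) := by rw [h4]; ring
  rcases ha.eq_or_lt with rfl | ha'
  · have hlim : Tendsto (fun b : ℝ => K * 2 ^ (γ + 1) * b ^ α * S ^ (1 - α)) (nhdsWithin 0 (Ioi 0))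
        (nhds (K * 2 ^ (γ + 1) * 0 ^ α * S ^ (1 - α))) :=
      (((Real.continuousAt_rpow_const 0 α (Or.inr hα.le)).tendsto.const_mul _).mul_const _).mono_left
        nhdsWithin_le_nhds
    refine ge_of_tendsto hlim ?_
    filter_upwards [Ioc_mem_nhdsGT hS] with b hb using key b hb.1 hb.1.le hb.2
  · exact key a ha' le_rfl haS

theorem exponent_bounds {n m : ℕ} {p : ℝ} (hn : 3 ≤ n) (hp2 : 2 ≤ p) (hp : (n : ℝ) / 2 < p)
    (hm : p / 2 ≤ ((n : ℝ) / ((n : ℝ) - 2)) ^ m) {q k τ₀ α : ℝ}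
    (hq : q = p / (p - 1)) (hk : k = (n : ℝ) / (((n : ℝ) - 2) * q)) (hτ₀ : τ₀ = 1 / 2 - 1 / p)
    (hα : α = (1 + 2 * τ₀) / (2 * (1 + τ₀) + (k - 1)⁻¹)) :
    n < 4 * (m + 1) ∧ 0 < α ∧ α ≤ 1 - (n : ℝ) / 2 / (2 * (m + 1) : ℕ) := by
  have hn' : (3 : ℝ) ≤ n := by exact_mod_cast hn
  have hn2 : (0 : ℝ) < n - 2 := by linarith
  have hn0 : (0 : ℝ) < n := by linarith
  have hp0 : 0 < p := by linarith
  have hp1 : 0 < p - 1 := by linarith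
  have hpn : 0 < 2 * p - n := by linarith
  have hb : p * (n - 2 * m) ≤ 2 * n := by
    have h1 : 1 - 2 * (m : ℝ) / n ≤ (((n : ℝ) - 2) / n) ^ m := by
      have h2 : (-2 : ℝ) ≤ -2 / n := by
        rw [le_div_iff₀ hn0]; linarith
      have := one_add_mul_le_pow h2 m
      calc 1 - 2 * (m : ℝ) / n = 1 + m * (-2 / n) := by ring
        _ ≤ _ := this
        _ = _ := by congr 1; field_simp; ring
    have h3 : (((n : ℝ) - 2) / n) ^ m * (p / 2) ≤ 1 := by
      calc (((n : ℝ) - 2) / n) ^ m * (p / 2)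
          ≤ (((n : ℝ) - 2) / n) ^ m * ((n : ℝ) / ((n : ℝ) - 2)) ^ m := by gcongr
        _ = 1 := by
          rw [← mul_pow, div_mul_div_cancel₀ hn0.ne', div_self hn2.ne', one_pow]
    have h4 : (1 - 2 * (m : ℝ) / n) * (p / 2) ≤ 1 :=
      (mul_le_mul_of_nonneg_right h1 (by positivity)).trans h3
    have h5 : (1 - 2 * (m : ℝ) / n) * (p / 2) * (2 * n) ≤ 1 * (2 * n) := by gcongr
    calc p * (n - 2 * m) = (1 - 2 * (m : ℝ) / n) * (p / 2) * (2 * n) := by field_simp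
      _ ≤ 2 * n := by linarith
  have hm0 : (0 : ℝ) ≤ m := m.cast_nonneg
  have hD : 0 < 4 * p + n * (p - 2) := by
    have := mul_nonneg hn0.le (sub_nonneg.2 hp2)
    linarith
  have hk1 : k - 1 = (2 * p - n) / ((n - 2) * p) := by
    rw [hk, hq]; field_simp; ring
  have hαeq : α = 1 - n * p / (4 * p + n * (p - 2)) := by
    have h1 : 2 * (1 + τ₀) + (k - 1)⁻¹ =
        (p - 1) * (4 * p + n * (p - 2)) / (p * (2 * p - n)) := by
      rw [hk1, hτ₀, inv_div]; field_simp; ring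
    have hD0 := hD.ne'
    have hpn0 := hpn.ne'
    have h2 : 1 - n * p / (4 * p + n * (p - 2)) =
        2 * (2 * p - n) / (4 * p + n * (p - 2)) := by
      rw [eq_div_iff hD0, sub_mul, div_mul_cancel₀ _ hD0]; ring
    have h3 : 1 + 2 * (1 / 2 - 1 / p) = 2 * (p - 1) / p := by field_simp; ring
    rw [hα, h1, hτ₀, h2, h3, div_div_div_eq, div_eq_div_iff
      (mul_ne_zero hp0.ne' (mul_ne_zero hp1.ne' hD0)) hD0]
    ring
  refine ⟨?_, ?_, ?_⟩
  · have h1 : (n : ℝ) - 2 * m < 4 := by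
      by_contra! h
      nlinarith
    have : (n : ℝ) < 4 * (m + 1) := by linarith
    exact_mod_cast this
  · rw [hαeq, sub_pos, div_lt_one hD]
    linarith
  · rw [hαeq]
    have : (n : ℝ) / 2 / (2 * (m + 1) : ℕ) ≤ n * p / (4 * p + n * (p - 2)) := by
      push_cast
      rw [div_div, div_le_div_iff₀ (by positivity) hD]
      have : 4 * p + n * (p - 2) ≤ p * (2 * (2 * (m + 1))) := by nlinarith
      calc (n : ℝ) * (4 * p + n * (p - 2)) ≤ n * (p * (2 * (2 * (m + 1)))) := by gcongr
        _ = _ := by ring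
    linarith

/-- `L²`-based multiplicative Sobolev inequality (Lemma 3.5 / inequality (3.7)
of the paper, Euclidean case): with `m` the least nonnegative integer such that
`(n/(n-2))^m ≥ p/2`, `q = p/(p-1)`, `k = n/((n-2)q)`, `τ₀ = 1/2 - 1/p` and
`α = (1+2τ₀)/(2(1+τ₀)+(k-1)⁻¹)`, one has
`sup_{B(0,r/2)} |u| ≤ C (⨍_{B(0,r)} u²)^{α/2}
  (∑_{j=0}^{m+1} binom(m+1,j) (⨍_{B(0,r)} (r^{2j} Δʲu)²)^{1/2})^{1-α}`. -/
theorem L2_multiplicative_sobolev_inequality (n : ℕ) (hn : 3 ≤ n)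
    (p : ℝ) (hp2 : 2 ≤ p) (hp : (n:ℝ) / 2 < p)
    (m : ℕ) (hm : p / 2 ≤ ((n:ℝ) / ((n:ℝ) - 2)) ^ m)
    (hm' : ∀ j : ℕ, j < m → ((n:ℝ) / ((n:ℝ) - 2)) ^ j < p / 2)
    (q k τ₀ α : ℝ)
    (hq : q = p / (p - 1)) (hk : k = (n:ℝ) / (((n:ℝ) - 2) * q))
    (hτ₀ : τ₀ = 1/2 - 1/p)
    (hα : α = (1 + 2 * τ₀) / (2 * (1 + τ₀) + (k - 1)⁻¹)) :
    ∃ C : ℝ, 0 < C ∧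
      ∀ r : ℝ, 0 < r →
        ∀ u : EuclideanSpace ℝ (Fin n) → ℝ,
          (∃ U : Set (EuclideanSpace ℝ (Fin n)), IsOpen U ∧
            Metric.closedBall (0 : EuclideanSpace ℝ (Fin n)) r ⊆ U ∧
            ContDiffOn ℝ (⊤ : ℕ∞) u U) →
          ∀ x ∈ Metric.ball (0 : EuclideanSpace ℝ (Fin n)) (r / 2),
            |u x| ≤ C *
              (((MeasureTheory.volume
                    (Metric.ball (0 : EuclideanSpace ℝ (Fin n)) r)).toReal)⁻¹
                * ∫ y in Metric.ball (0 : EuclideanSpace ℝ (Fin n)) r,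
                    (u y) ^ 2) ^ (α / 2)
              * (∑ j ∈ Finset.range (m + 2), ((m + 1).choose j : ℝ) *
                  (((MeasureTheory.volume
                        (Metric.ball (0 : EuclideanSpace ℝ (Fin n)) r)).toReal)⁻¹
                    * ∫ y in Metric.ball (0 : EuclideanSpace ℝ (Fin n)) r,
                        (r ^ (2 * j) * lapIter j u y) ^ 2) ^ ((1:ℝ)/2)) ^ (1 - α) := by
  obtain ⟨hnm, hα0, hα1⟩ := exponent_bounds hn hp2 hp hm hq hk hτ₀ hα
  obtain ⟨C, hC, hmain⟩ := exists_abs_apply_le m hnm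
  set V := (volume (ball (0 : EuclideanSpace ℝ (Fin n)) 1)).toReal with hV
  have hV0 : 0 < V := ENNReal.toReal_pos (measure_ball_pos _ _ one_pos).ne' measure_ball_lt_top.ne
  refine ⟨C * √V * 2 ^ ((n : ℝ) / 2 + 1), by positivity, fun r hr u ⟨U, hU, hrU, hu⟩ x hx => ?_⟩
  obtain ⟨v, hv, hvc, hvu⟩ := exists_contDiff_hasCompactSupport_eventuallyEq hr hU hrU hu
  have hvol : (volume (ball (0 : EuclideanSpace ℝ (Fin n)) r)).toReal = r ^ n * V := by
    rw [Measure.addHaar_ball_of_pos _ _ hr, ENNReal.toReal_mul, finrank_euclideanSpace_fin,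
      ENNReal.toReal_ofReal (by positivity)]
  have hlap (j : ℕ) (y) (hy : y ∈ ball (0 : EuclideanSpace ℝ (Fin n)) r) :
      lapIter j v y = lapIter j u y :=
    ((hvu y (ball_subset_closedBall hy)).lapIter j).eq_of_nhds
  set A : ℕ → ℝ := fun j => √((r ^ n * V)⁻¹ *
    ∫ y in ball (0 : EuclideanSpace ℝ (Fin n)) r, (r ^ (2 * j) * lapIter j v y) ^ 2) with hA
  have hA0 (j : ℕ) : 0 ≤ A j := Real.sqrt_nonneg _
  have hterm (j : ℕ) : (((volume (ball (0 : EuclideanSpace ℝ (Fin n)) r)).toReal)⁻¹ *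
      ∫ y in ball (0 : EuclideanSpace ℝ (Fin n)) r,
        (r ^ (2 * j) * lapIter j u y) ^ 2) ^ ((1 : ℝ) / 2) = A j := by
    rw [hvol, ← Real.sqrt_eq_rpow]
    simp only [hA]
    congr 2
    exact setIntegral_congr_fun measurableSet_ball fun y hy => by simp only [hlap j y hy]
  have hfirst : (((volume (ball (0 : EuclideanSpace ℝ (Fin n)) r)).toReal)⁻¹ *
      ∫ y in ball (0 : EuclideanSpace ℝ (Fin n)) r, (u y) ^ 2) ^ (α / 2) = A 0 ^ α := by
    rw [← hterm 0, ← Real.rpow_mul]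
    · simp [lapIter]; ring_nf
    · exact mul_nonneg (by positivity) (integral_nonneg fun y => sq_nonneg _)
  simp_rw [hterm]
  rw [hfirst]
  set S := ∑ j ∈ Finset.range (m + 2), ((m + 1).choose j : ℝ) * A j with hS
  have hAS (j : ℕ) (hj : j ∈ Finset.range (m + 2)) : ((m + 1).choose j : ℝ) * A j ≤ S :=
    Finset.single_le_sum (f := fun j => ((m + 1).choose j : ℝ) * A j)
      (fun j _ => mul_nonneg (Nat.cast_nonneg _) (hA0 j)) hj
  have hA0S : A 0 ≤ S := by simpa using hAS 0 (by simp)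
  have hAmS : A (m + 1) ≤ S := by simpa using hAS (m + 1) (by simp)
  refine le_rpow_mul_rpow_of_forall_le (N := 2 * (m + 1)) (by positivity)
    (by positivity) (hA0 0) hA0S hα0 hα1 fun t ht ht' => ?_
  have hux : u x = v x :=
    (hlap 0 x (ball_subset_ball (by linarith) hx)).symm
  have hsub : ball x (t * r) ⊆ ball (0 : EuclideanSpace ℝ (Fin n)) r := by
    refine ball_subset_ball' ?_
    rw [mem_ball] at hx
    nlinarith
  have hscale (j : ℕ) : √(((t * r) ^ n)⁻¹ *
      ∫ y in ball x (t * r), ((t * r) ^ (2 * j) * lapIter j v y) ^ 2) ≤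
      √V * (t ^ (-((n : ℝ) / 2)) * (t ^ (2 * j) * A j)) := by
    have hcont : Continuous fun y => (r ^ (2 * j) * lapIter j v y) ^ 2 := by
      have := (contDiff_lapIter hv j).continuous
      fun_prop
    have h1 : ∫ y in ball x (t * r), ((t * r) ^ (2 * j) * lapIter j v y) ^ 2 ≤
        (t ^ (2 * j)) ^ 2 * ∫ y in ball (0 : EuclideanSpace ℝ (Fin n)) r,
          (r ^ (2 * j) * lapIter j v y) ^ 2 := by
      simp_rw [mul_pow t r, mul_assoc, mul_pow (t ^ (2 * j)), integral_const_mul]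
      refine mul_le_mul_of_nonneg_left ?_ (by positivity)
      refine setIntegral_mono_set ?_ (ae_of_all _ fun y => sq_nonneg _) hsub.eventuallyLE
      exact (hcont.continuousOn.integrableOn_compact (isCompact_closedBall 0 r)).mono_set
        ball_subset_closedBall
    have h2 : t ^ (-((n : ℝ) / 2)) = √(t ^ n)⁻¹ := by
      rw [Real.sqrt_eq_rpow, ← Real.rpow_natCast, ← Real.rpow_neg ht.le, ← Real.rpow_mul ht.le]
      ring_nf
    rw [h2, ← Real.sqrt_sq (show 0 ≤ t ^ (2 * j) by positivity), hA,
      ← Real.sqrt_mul (by positivity), ← Real.sqrt_mul (by positivity),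
      ← Real.sqrt_mul (by positivity)]
    refine Real.sqrt_le_sqrt ((mul_le_mul_of_nonneg_left h1 (by positivity)).trans (le_of_eq ?_))
    field_simp
    ring
  rw [hux]
  refine (hmain v hv hvc x (t * r) (by positivity)).trans ?_
  rw [mul_assoc C]
  refine mul_le_mul_of_nonneg_left ?_ hC.le
  have h0 := hscale 0
  simp only [mul_zero, pow_zero, one_mul] at h0
  have h1 := hscale (m + 1)
  calc _ ≤ √V * (t ^ (-((n : ℝ) / 2)) * A 0) +
        √V * (t ^ (-((n : ℝ) / 2)) * (t ^ (2 * (m + 1)) * A (m + 1))) := add_le_add h0 h1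
    _ = √V * (t ^ (-((n : ℝ) / 2)) * (A 0 + t ^ (2 * (m + 1)) * A (m + 1))) := by ring
    _ ≤ _ := by gcongr
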